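/- For all x in [0,1], all positive integers n, and 0<q<1, the first central q-moment of the q-Durrmeyer operator satisfies D_{n,q}((t-x)_q; x) = (1 - (1 + q^{n+1}) x)/[n+2]_q. -/

import Mathlib

open Finset Filter Topology

/-- The q-integer `[n]_q = 1 + q + ⋯ + q^(n-1)`. -/
noncomputable def qInt (q : ℝ) (n : ℕ) : ℝ := ∑ i ∈ Finset.range n, q ^ i

/-- The q-factorial `[n]_q!`. -/
noncomputable def qFact (q : ℝ) (n : ℕ) : ℝ := ∏ i ∈ Finset.range n, qInt q (i + 1)

/-- The q-binomial coefficient. -/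
noncomputable def qBinom (q : ℝ) (n k : ℕ) : ℝ := qFact q n / (qFact q k * qFact q (n - k))

/-- `(1 - x)_q^n = ∏_{j=0}^{n-1} (1 - q^j x)`. -/
noncomputable def qOneSubPow (q x : ℝ) (n : ℕ) : ℝ := ∏ j ∈ Finset.range n, (1 - q ^ j * x)

/-- The q-Bernstein basis `p_{nk}(q;x)`. -/
noncomputable def qBern (q : ℝ) (n k : ℕ) (x : ℝ) : ℝ :=
  qBinom q n k * x ^ k * qOneSubPow q x (n - k)

/-- The Jackson q-integral on `[0,1]`. -/
noncomputable def qIntegral (q : ℝ) (g : ℝ → ℝ) : ℝ := (1 - q) * ∑' j : ℕ, q ^ j * g (q ^ j)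

/-- The q-Durrmeyer operator `D_{n,q}(f;x)`. -/
noncomputable def qDurrmeyer (q : ℝ) (n : ℕ) (f : ℝ → ℝ) (x : ℝ) : ℝ :=
  qInt q (n + 1) * ∑ k ∈ Finset.range (n + 1),
    q ^ (-(k : ℤ)) * qBern q n k x * qIntegral q (fun t => f t * qBern q n k (q * t))

/-- The q-Durrmeyer–Stancu operator `D_{n,q}^{α,β}(f;x)`. -/
noncomputable def qDurrmeyerStancu (q : ℝ) (n : ℕ) (α β : ℝ) (f : ℝ → ℝ) (x : ℝ) : ℝ :=
  qDurrmeyer q n (fun t => f ((qInt q n * t + α) / (qInt q n + β))) x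

/-- The q-derivative `D_q f(x) = (f(qx) - f(x)) / ((q-1)x)`. -/
noncomputable def qDeriv (q : ℝ) (f : ℝ → ℝ) (x : ℝ) : ℝ := (f (q * x) - f x) / ((q - 1) * x)

/-- The q-power `(t - x)_q^m = ∏_{j=0}^{m-1} (t - q^j x)`, as a function of `t`. -/
noncomputable def qCentral (q x : ℝ) (m : ℕ) (t : ℝ) : ℝ := ∏ j ∈ Finset.range m, (t - q ^ j * x)

theorem qInt_pos {q : ℝ} (hq : 0 < q) {n : ℕ} (hn : 0 < n) : 0 < qInt q n :=
  Finset.sum_pos (fun _ _ => pow_pos hq _) ⟨0, Finset.mem_range.2 hn⟩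

theorem qInt_add (q : ℝ) (m n : ℕ) : qInt q (m + n) = qInt q m + q ^ m * qInt q n := by
  simp only [qInt, Finset.sum_range_add, Finset.mul_sum, pow_add]

theorem one_sub_mul_qInt (q : ℝ) (n : ℕ) : (1 - q) * qInt q n = 1 - q ^ n :=
  mul_neg_geom_sum q n

theorem qFact_succ (q : ℝ) (n : ℕ) : qFact q (n + 1) = qFact q n * qInt q (n + 1) :=
  Finset.prod_range_succ _ _

theorem qFact_zero (q : ℝ) : qFact q 0 = 1 := Finset.prod_range_zero _

theorem qFact_pos {q : ℝ} (hq : 0 < q) (n : ℕ) : 0 < qFact q n :=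
  Finset.prod_pos fun i _ => qInt_pos hq i.succ_pos

theorem qOneSubPow_succ (q x : ℝ) (n : ℕ) :
    qOneSubPow q x (n + 1) = qOneSubPow q x n * (1 - q ^ n * x) :=
  Finset.prod_range_succ _ _

/-- The Jackson integral evaluating the q-Beta function, as a convergent series. -/
theorem hasSum_qBeta {q : ℝ} (hq0 : 0 < q) (hq1 : q < 1) (m k : ℕ) :
    HasSum (fun i : ℕ => q ^ i * ((q ^ i) ^ k * qOneSubPow q (q * q ^ i) m))
      (qFact q k * qFact q m / qFact q (k + m + 1) / (1 - q)) := by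
  have hq : 1 - q ≠ 0 := (sub_pos.2 hq1).ne'
  induction m generalizing k with
  | zero =>
    have h := hasSum_geometric_of_lt_one (pow_nonneg hq0.le (k + 1))
      (pow_lt_one₀ hq0.le hq1 k.succ_ne_zero)
    convert h using 1
    · funext i
      simp only [qOneSubPow, Finset.prod_range_zero]
      ring
    · have h1 := (qFact_pos hq0 k).ne'
      have h2 := (qInt_pos hq0 k.succ_pos).ne'
      rw [← one_sub_mul_qInt, Nat.add_zero, qFact_succ, qFact_zero]
      field_simp
  | succ m ih =>
    have h := (ih k).sub ((ih (k + 1)).mul_left (q ^ (m + 1)))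
    convert h using 1
    · rfl
    · funext i
      rw [qOneSubPow_succ]
      ring
    · have h1 := (qFact_pos hq0 (k + m + 1)).ne'
      have h2 := (qInt_pos hq0 (k + m + 1).succ_pos).ne'
      have h3 := qInt_add q (m + 1) (k + 1)
      rw [show m + 1 + (k + 1) = k + m + 1 + 1 by ring] at h3
      rw [show k + (m + 1) + 1 = k + m + 1 + 1 by ring,
        show k + 1 + m + 1 = k + m + 1 + 1 by ring, qFact_succ q k, qFact_succ q m,
        qFact_succ q (k + m + 1)]
      simp only [Nat.succ_eq_add_one] at h2
      field_simp
      rw [h3]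
      ring

theorem qBern_zero_succ {q : ℝ} (hq : 0 < q) (n : ℕ) (x : ℝ) :
    qBern q (n + 1) 0 x = qBern q n 0 x - q ^ n * x * qBern q n 0 x := by
  have h1 := (qFact_pos hq n).ne'
  have h2 := (qFact_pos hq (n + 1)).ne'
  simp only [qBern, qBinom, qFact_zero, Nat.sub_zero, qOneSubPow_succ, one_mul, div_self h1,
    div_self h2]
  ring

theorem qBern_self {q : ℝ} (hq : 0 < q) (n : ℕ) (x : ℝ) : qBern q n n x = x ^ n := by
  simp [qBern, qBinom, qFact_zero, qOneSubPow, (qFact_pos hq n).ne']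

/-- The q-Pascal rule for the q-Bernstein basis. -/
theorem qBern_succ_succ {q : ℝ} (hq : 0 < q) {n k : ℕ} (hk : k < n) (x : ℝ) :
    qBern q (n + 1) (k + 1) x = qBern q n (k + 1) x +
      (q ^ (n - k) * x * qBern q n k x - q ^ (n - (k + 1)) * x * qBern q n (k + 1) x) := by
  obtain ⟨m, rfl⟩ := Nat.exists_eq_add_of_lt hk
  have h1 := (qFact_pos hq k).ne'
  have h2 := (qFact_pos hq m).ne'
  have h3 := (qInt_pos hq k.succ_pos).ne'
  have h4 := (qInt_pos hq m.succ_pos).ne'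
  have h5 := qInt_add q (m + 1) (k + 1)
  rw [show m + 1 + (k + 1) = k + m + 1 + 1 by ring] at h5
  simp only [Nat.succ_eq_add_one] at h3 h4
  simp only [qBern, qBinom, show k + m + 1 + 1 - (k + 1) = m + 1 by lia,
    show k + m + 1 - k = m + 1 by lia, show k + m + 1 - (k + 1) = m by lia,
    qFact_succ q (k + m + 1), qFact_succ q k, qFact_succ q m, qOneSubPow_succ, h5]
  field_simp
  ring

theorem sum_qBern {q : ℝ} (hq : 0 < q) (n : ℕ) (x : ℝ) :
    ∑ k ∈ Finset.range (n + 1), qBern q n k x = 1 := by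
  induction n with
  | zero => simp [qBern_self hq]
  | succ n ih =>
    rw [Finset.sum_range_succ, Finset.sum_range_succ',
      Finset.sum_congr rfl fun k hk => qBern_succ_succ hq (Finset.mem_range.1 hk) x,
      Finset.sum_add_distrib,
      Finset.sum_range_sub' (fun k => q ^ (n - k) * x * qBern q n k x), qBern_zero_succ hq,
      qBern_self hq, qBern_self hq]
    rw [Finset.sum_range_succ'] at ih
    simp only [Nat.sub_self, Nat.sub_zero]
    linear_combination ih

theorem qBern_succ_mul_qInt {q : ℝ} (hq : 0 < q) (n k : ℕ) (x : ℝ) :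
    qBern q (n + 1) (k + 1) x * qInt q (k + 1) = qInt q (n + 1) * x * qBern q n k x := by
  have h1 := (qFact_pos hq k).ne'
  have h2 := (qFact_pos hq (n - k)).ne'
  have h3 := (qInt_pos hq k.succ_pos).ne'
  simp only [Nat.succ_eq_add_one] at h3
  simp only [qBern, qBinom, Nat.add_sub_add_right, qFact_succ]
  field_simp
  ring

theorem sum_qBern_mul_qInt {q : ℝ} (hq : 0 < q) (n : ℕ) (x : ℝ) :
    ∑ k ∈ Finset.range (n + 1), qBern q n k x * qInt q k = qInt q n * x := by
  cases n with
  | zero => simp [qInt]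
  | succ n =>
    rw [Finset.sum_range_succ', Finset.sum_congr rfl fun k _ => qBern_succ_mul_qInt hq n k x,
      ← Finset.mul_sum, sum_qBern hq]
    simp [qInt]

/-- The Jackson integral of `t - x` against a q-Bernstein basis polynomial. -/
theorem qIntegral_sub_mul_qBern {q : ℝ} (hq0 : 0 < q) (hq1 : q < 1) {n k : ℕ} (hk : k ≤ n)
    (x : ℝ) :
    qIntegral q (fun t => (t - x) * qBern q n k (q * t)) =
      q ^ k * (qInt q (k + 1) / qInt q (n + 2) - x) / qInt q (n + 1) := by
  obtain ⟨m, rfl⟩ := Nat.exists_eq_add_of_le hk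
  have h := ((hasSum_qBeta hq0 hq1 m (k + 1)).sub
    ((hasSum_qBeta hq0 hq1 m k).mul_left x)).mul_left (qBinom q (k + m) k * q ^ k)
  have hfun : (fun i : ℕ => q ^ i * ((q ^ i - x) * qBern q (k + m) k (q * q ^ i))) =
      fun i : ℕ => qBinom q (k + m) k * q ^ k *
        (q ^ i * ((q ^ i) ^ (k + 1) * qOneSubPow q (q * q ^ i) m) -
          x * (q ^ i * ((q ^ i) ^ k * qOneSubPow q (q * q ^ i) m))) := by
    funext i
    rw [qBern, Nat.add_sub_cancel_left]
    ring
  rw [qIntegral, hfun, h.tsum_eq, qBinom, Nat.add_sub_cancel_left,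
    show k + 1 + m + 1 = k + m + 1 + 1 by ring, qFact_succ q (k + m + 1), qFact_succ q (k + m),
    qFact_succ q k]
  have hq : 1 - q ≠ 0 := (sub_pos.2 hq1).ne'
  have h1 := (qFact_pos hq0 k).ne'
  have h2 := (qFact_pos hq0 m).ne'
  have h3 := (qFact_pos hq0 (k + m)).ne'
  have h4 : qInt q (k + m + 1) ≠ 0 := (qInt_pos hq0 (k + m).succ_pos).ne'
  have h5 : qInt q (k + m + 1 + 1) ≠ 0 := (qInt_pos hq0 (k + m + 1).succ_pos).ne'
  rw [show k + m + 2 = k + m + 1 + 1 by ring]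
  field_simp

/-- First central q-moment of the q-Durrmeyer operator. -/
theorem qDurrmeyer_first_central_moment (q x : ℝ) (hq0 : 0 < q) (hq1 : q < 1)
    (n : ℕ) (hn : 0 < n) (hx : x ∈ Set.Icc (0 : ℝ) 1) :
    qDurrmeyer q n (qCentral q x 1) x = (1 - (1 + q ^ (n + 1)) * x) / qInt q (n + 2) := by
  have h1 : qInt q (n + 1) ≠ 0 := (qInt_pos hq0 n.succ_pos).ne'
  have h2 : qInt q (n + 2) ≠ 0 := (qInt_pos hq0 (n + 1).succ_pos).ne'
  have hqk (k : ℕ) : qInt q (k + 1) = 1 + q * qInt q k := by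
    rw [add_comm, qInt_add]
    simp [qInt]
  have hn2 : qInt q (n + 2) = 1 + q * qInt q n + q ^ (n + 1) := by
    rw [← hqk, qInt, Finset.sum_range_succ, qInt]
  have hterm : ∀ k ∈ Finset.range (n + 1),
      q ^ (-(k : ℤ)) * qBern q n k x *
        qIntegral q (fun t => qCentral q x 1 t * qBern q n k (q * t)) =
      (qInt q (n + 1))⁻¹ * ((qInt q (n + 2))⁻¹ * qBern q n k x +
        q * (qInt q (n + 2))⁻¹ * (qBern q n k x * qInt q k) - x * qBern q n k x) := by
    intro k hk
    have hqk0 : q ^ k ≠ 0 := (pow_pos hq0 k).ne'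
    simp only [qCentral, Finset.prod_range_one, pow_zero, one_mul]
    rw [qIntegral_sub_mul_qBern hq0 hq1 (Nat.lt_succ_iff.1 (Finset.mem_range.1 hk)), hqk k,
      zpow_neg, zpow_natCast]
    field_simp
  rw [qDurrmeyer, Finset.sum_congr rfl hterm, ← Finset.mul_sum, Finset.sum_sub_distrib,
    Finset.sum_add_distrib, ← Finset.mul_sum, ← Finset.mul_sum, ← Finset.mul_sum, sum_qBern hq0,
    sum_qBern_mul_qInt hq0]
  field_simp
  rw [hn2]
  ring
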